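/- Let g: ℂ → ℝ_{≥0} be a non-negative smooth function with ‖g‖_{C^k(ℂ)} < ∞ for all k ≥ 0, and suppose g satisfies the following non-degeneracy condition: there exist δ > 0 and R > 0 such that for all p ∈ ℂ one has sup_{z ∈ D_R(p)} g(z) ≥ δ. Then there exists a smooth function φ: ℂ → ℝ satisfying −Δφ + φ = −g on ℂ, ‖φ‖_{C^k(ℂ)} < ∞ for all k ≥ 0, and sup_{z∈ℂ} φ(z) < 0. -/

import Mathlib

open Filter

/-- The Laplacian `∂²φ/∂x² + ∂²φ/∂y²` of a function `φ : ℂ → ℝ`,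
identifying `ℂ` with `ℝ²` via `z = x + iy`. -/
noncomputable def laplacian (φ : ℂ → ℝ) (z : ℂ) : ℝ :=
  iteratedFDeriv ℝ 2 φ z ![1, 1] + iteratedFDeriv ℝ 2 φ z ![Complex.I, Complex.I]

open MeasureTheory Set Topology

/-- Smooth functions on `ℂ` all of whose iterated derivatives are bounded. -/
def IsBoundedSmooth {F : Type*} [NormedAddCommGroup F] [NormedSpace ℝ F] (G : ℂ → F) : Prop :=
  ContDiff ℝ (⊤ : ℕ∞) G ∧ ∀ k : ℕ, ∃ C : ℝ, ∀ z : ℂ, ‖iteratedFDeriv ℝ k G z‖ ≤ C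

namespace IsBoundedSmooth

variable {F : Type*} [NormedAddCommGroup F] [NormedSpace ℝ F] {G : ℂ → F}

theorem exists_norm_le (hG : IsBoundedSmooth G) : ∃ C : ℝ, 0 ≤ C ∧ ∀ z, ‖G z‖ ≤ C := by
  obtain ⟨C, hC⟩ := hG.2 0
  simp only [norm_iteratedFDeriv_zero] at hC
  exact ⟨C, (norm_nonneg _).trans (hC 0), hC⟩

theorem derivative (hG : IsBoundedSmooth G) : IsBoundedSmooth (fderiv ℝ G) := by
  refine ⟨hG.1.fderiv_right (by simp), fun k ↦ ?_⟩
  simpa only [norm_iteratedFDeriv_fderiv] using hG.2 (k + 1)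

theorem continuous (hG : IsBoundedSmooth G) : Continuous G := hG.1.continuous

theorem hasFDerivAt (hG : IsBoundedSmooth G) (z : ℂ) : HasFDerivAt G (fderiv ℝ G z) z :=
  (hG.1.differentiable (by simp) z).hasFDerivAt

theorem comp_const_add (hG : IsBoundedSmooth G) (a : ℂ) : IsBoundedSmooth fun z ↦ G (a + z) := by
  refine ⟨hG.1.comp (contDiff_const.add contDiff_id), fun k ↦ ?_⟩
  obtain ⟨C, hC⟩ := hG.2 k
  exact ⟨C, fun z ↦ by simpa only [iteratedFDeriv_comp_add_left] using hC (a + z)⟩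

variable {Ω : Type*} [MeasurableSpace Ω] {μ : Measure Ω} [IsFiniteMeasure μ] {X : Ω → ℂ}

theorem integrable_comp_const_add (hG : IsBoundedSmooth G) (hX : Measurable X) (z : ℂ) :
    Integrable (fun ω ↦ G (z + X ω)) μ := by
  obtain ⟨C, -, hC⟩ := hG.exists_norm_le
  exact Integrable.of_bound (hG.continuous.comp_aestronglyMeasurable
    (hX.const_add z).aestronglyMeasurable) C (.of_forall fun ω ↦ hC _)

theorem hasFDerivAt_integral_translate (hG : IsBoundedSmooth G) (hX : Measurable X) (z : ℂ) :
    HasFDerivAt (fun z ↦ ∫ ω, G (z + X ω) ∂μ) (∫ ω, fderiv ℝ G (z + X ω) ∂μ) z := by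
  obtain ⟨C, -, hC⟩ := hG.derivative.exists_norm_le
  refine hasFDerivAt_integral_of_dominated_of_fderiv_le (bound := fun _ ↦ C)
    (F' := fun z ω ↦ fderiv ℝ G (z + X ω)) Filter.univ_mem
    (.of_forall fun z ↦ (hG.integrable_comp_const_add hX z).aestronglyMeasurable)
    (hG.integrable_comp_const_add hX z)
    (hG.derivative.integrable_comp_const_add hX z).aestronglyMeasurable
    (.of_forall fun ω x _ ↦ hC _) (integrable_const C) (.of_forall fun ω x _ ↦ ?_)
  exact (hG.hasFDerivAt (x + X ω)).comp x ((hasFDerivAt_id x).add_const (X ω))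

theorem fderiv_integral_translate (hG : IsBoundedSmooth G) (hX : Measurable X) :
    fderiv ℝ (fun z ↦ ∫ ω, G (z + X ω) ∂μ)
      = fun z ↦ ∫ ω, fderiv ℝ G (z + X ω) ∂μ :=
  funext fun z ↦ (hG.hasFDerivAt_integral_translate hX z).fderiv

end IsBoundedSmooth

theorem IsBoundedSmooth.integral_translate_aux {Ω : Type*} [MeasurableSpace Ω] {μ : Measure Ω}
    [IsFiniteMeasure μ] {X : Ω → ℂ} (hX : Measurable X) (k : ℕ) :
    ∀ {F : Type} [NormedAddCommGroup F] [NormedSpace ℝ F] {G : ℂ → F}, IsBoundedSmooth G →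
      ContDiff ℝ k (fun z ↦ ∫ ω, G (z + X ω) ∂μ) ∧
      ∃ C : ℝ, ∀ z : ℂ, ‖iteratedFDeriv ℝ k (fun z ↦ ∫ ω, G (z + X ω) ∂μ) z‖ ≤ C := by
  induction k with
  | zero =>
    intro F _ _ G hG
    refine ⟨contDiff_zero.2 (continuous_iff_continuousAt.2 fun z ↦
      (hG.hasFDerivAt_integral_translate hX z).continuousAt), ?_⟩
    obtain ⟨C, -, hC⟩ := hG.exists_norm_le
    refine ⟨C * μ.real univ, fun z ↦ ?_⟩
    rw [norm_iteratedFDeriv_zero]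
    exact norm_integral_le_of_norm_le_const (.of_forall fun ω ↦ hC _)
  | succ k ih =>
    intro F _ _ G hG
    obtain ⟨h₁, C, hC⟩ := ih hG.derivative
    rw [← hG.fderiv_integral_translate hX] at h₁ hC
    refine ⟨?_, C, fun z ↦ by rw [← norm_iteratedFDeriv_fderiv]; exact hC z⟩
    push_cast
    exact contDiff_succ_iff_fderiv.2
      ⟨fun z ↦ (hG.hasFDerivAt_integral_translate hX z).differentiableAt, by simp, h₁⟩

theorem IsBoundedSmooth.integral_translate {Ω : Type*} [MeasurableSpace Ω] {μ : Measure Ω}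
    [IsFiniteMeasure μ] {X : Ω → ℂ} (hX : Measurable X) {F : Type} [NormedAddCommGroup F]
    [NormedSpace ℝ F] {G : ℂ → F} (hG : IsBoundedSmooth G) :
    IsBoundedSmooth fun z ↦ ∫ ω, G (z + X ω) ∂μ :=
  ⟨contDiff_infty.2 fun k ↦ (integral_translate_aux hX k hG).1,
    fun k ↦ (integral_translate_aux hX k hG).2⟩

theorem laplacian_eq_fderiv_fderiv (h : ℂ → ℝ) (z : ℂ) :
    laplacian h z = fderiv ℝ (fderiv ℝ h) z 1 1
      + fderiv ℝ (fderiv ℝ h) z Complex.I Complex.I := by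
  simp [laplacian, iteratedFDeriv_two_apply]

theorem IsBoundedSmooth.laplacian_continuous {h : ℂ → ℝ} (hh : IsBoundedSmooth h) :
    Continuous (laplacian h) := by
  have h1 := hh.derivative.derivative.continuous
  rw [funext (laplacian_eq_fderiv_fderiv h)]
  fun_prop

theorem IsBoundedSmooth.laplacian_bounded {h : ℂ → ℝ} (hh : IsBoundedSmooth h) :
    ∃ C : ℝ, ∀ z, ‖laplacian h z‖ ≤ C := by
  obtain ⟨C, -, hC⟩ := hh.derivative.derivative.exists_norm_le
  have key (z v : ℂ) (hv : ‖v‖ = 1) : ‖fderiv ℝ (fderiv ℝ h) z v v‖ ≤ C := by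
    have := (fderiv ℝ (fderiv ℝ h) z).le_opNorm₂ v v
    rw [hv, mul_one, mul_one] at this
    exact this.trans (hC z)
  refine ⟨C + C, fun z ↦ ?_⟩
  rw [laplacian_eq_fderiv_fderiv]
  exact norm_add_le_of_le (key z 1 (by simp)) (key z _ (by simp))

theorem IsBoundedSmooth.laplacian_integral_translate {Ω : Type*} [MeasurableSpace Ω]
    {μ : Measure Ω} [IsFiniteMeasure μ] {X : Ω → ℂ} (hX : Measurable X) {h : ℂ → ℝ}
    (hh : IsBoundedSmooth h) (z : ℂ) :
    laplacian (fun z ↦ ∫ ω, h (z + X ω) ∂μ) z = ∫ ω, laplacian h (z + X ω) ∂μ := by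
  have hi := hh.derivative.derivative.integrable_comp_const_add (μ := μ) hX z
  have hi' (v : ℂ) := hi.apply_continuousLinearMap v
  simp only [laplacian_eq_fderiv_fderiv, hh.fderiv_integral_translate hX,
    hh.derivative.fderiv_integral_translate hX]
  rw [integral_add ((hi' 1).apply_continuousLinearMap 1)
    ((hi' Complex.I).apply_continuousLinearMap Complex.I)]
  simp only [ContinuousLinearMap.integral_apply hi,
    ContinuousLinearMap.integral_apply (hi' _)]

/-! ### The Gaussian semigroup -/

theorem integrable_exp_neg_mul_sq_norm {b : ℝ} (hb : 0 < b) :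
    Integrable fun w : ℂ ↦ Real.exp (-b * ‖w‖ ^ 2) := by
  refine .of_integral_ne_zero ?_
  rw [GaussianFourier.integral_rexp_neg_mul_sq_norm hb]
  positivity

theorem integrable_gaussian : Integrable fun w : ℂ ↦ Real.exp (-‖w‖ ^ 2) := by
  simpa using integrable_exp_neg_mul_sq_norm one_pos

theorem integral_gaussian_complex_norm : ∫ w : ℂ, Real.exp (-‖w‖ ^ 2) = Real.pi := by
  have := GaussianFourier.integral_rexp_neg_mul_sq_norm (V := ℂ) one_pos
  simpa using this

theorem integrable_norm_mul_gaussian :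
    Integrable fun w : ℂ ↦ ‖w‖ * Real.exp (-‖w‖ ^ 2) := by
  refine (integrable_exp_neg_mul_sq_norm (b := 1 / 2) (by norm_num)).mono'
    (by fun_prop) (.of_forall fun w ↦ ?_)
  rw [Real.norm_of_nonneg (by positivity)]
  have h1 : ‖w‖ ≤ Real.exp (1 / 2 * ‖w‖ ^ 2) := by
    nlinarith [Real.add_one_le_exp (1 / 2 * ‖w‖ ^ 2), sq_nonneg (‖w‖ - 1)]
  calc ‖w‖ * Real.exp (-‖w‖ ^ 2)
      ≤ Real.exp (1 / 2 * ‖w‖ ^ 2) * Real.exp (-‖w‖ ^ 2) := by gcongr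
    _ = Real.exp (-(1 / 2) * ‖w‖ ^ 2) := by rw [← Real.exp_add]; ring_nf

theorem integrable_gaussian_mul {f : ℂ → ℝ} (hf : Continuous f) {C : ℝ} (hC : ∀ w, ‖f w‖ ≤ C) :
    Integrable fun w : ℂ ↦ Real.exp (-‖w‖ ^ 2) * f w :=
  integrable_gaussian.mul_bdd hf.aestronglyMeasurable (.of_forall hC)

theorem hasFDerivAt_gaussian (w : ℂ) :
    HasFDerivAt (fun w : ℂ ↦ Real.exp (-‖w‖ ^ 2))
      ((-2 * Real.exp (-‖w‖ ^ 2)) • innerSL ℝ w) w := by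
  have h := ((hasFDerivAt_id w).norm_sq.neg).exp
  refine h.congr_fderiv ?_
  ext v
  simp
  ring

theorem integral_gaussian_mul_lineDeriv {f f' : ℂ → ℝ} {v : ℂ}
    (hf : ∀ w, HasLineDerivAt ℝ f (f' w) w v) (hfc : Continuous f) (hfc' : Continuous f')
    {C C' : ℝ} (hC : ∀ w, ‖f w‖ ≤ C) (hC' : ∀ w, ‖f' w‖ ≤ C') :
    Integrable (fun w : ℂ ↦ 2 * (inner ℝ w v * Real.exp (-‖w‖ ^ 2) * f w)) ∧
    ∫ w : ℂ, Real.exp (-‖w‖ ^ 2) * f' w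
      = ∫ w : ℂ, 2 * (inner ℝ w v * Real.exp (-‖w‖ ^ 2) * f w) := by
  have hi : Integrable fun w : ℂ ↦ inner ℝ w v * Real.exp (-‖w‖ ^ 2) := by
    refine (integrable_norm_mul_gaussian.mul_const ‖v‖).mono' (by fun_prop)
      (.of_forall fun w ↦ ?_)
    rw [norm_mul, Real.norm_of_nonneg (Real.exp_pos _).le, mul_right_comm]
    gcongr
    exact norm_inner_le_norm w v
  have hi' := (hi.mul_bdd hfc.aestronglyMeasurable (.of_forall hC)).const_mul 2
  refine ⟨hi', ?_⟩
  have key := integral_bilinear_hasLineDerivAt_right_eq_neg_left_of_integrable (μ := volume)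
    (B := ContinuousLinearMap.mul ℝ ℝ) (v := v) (f := fun w : ℂ ↦ Real.exp (-‖w‖ ^ 2))
    (f' := fun w ↦ -2 * Real.exp (-‖w‖ ^ 2) * inner ℝ w v) (g := f) (g' := f') ?_
    (integrable_gaussian_mul hfc' hC') (integrable_gaussian_mul hfc hC)
    (fun w _ ↦ by simpa using (hasFDerivAt_gaussian w).hasLineDerivAt v) (fun w _ ↦ hf w)
  · simp only [ContinuousLinearMap.mul_apply'] at key
    rw [key, ← integral_neg]
    congr 1 with w
    ring
  · refine hi'.neg.congr (.of_forall fun w ↦ ?_)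
    simp only [Pi.neg_apply, ContinuousLinearMap.mul_apply']
    ring

theorem IsBoundedSmooth.hasDerivAt_gaussian_integral {h : ℂ → ℝ} (hh : IsBoundedSmooth h)
    (s : ℝ) :
    HasDerivAt (fun s : ℝ ↦ ∫ w : ℂ, Real.exp (-‖w‖ ^ 2) * h ((2 * s) • w))
      (2 * s * ∫ w : ℂ, Real.exp (-‖w‖ ^ 2) * laplacian h ((2 * s) • w)) s := by
  have hc := hh.continuous
  have hc' := hh.derivative.continuous
  have hc'' := hh.derivative.derivative.continuous
  obtain ⟨C, -, hC⟩ := hh.exists_norm_le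
  obtain ⟨C', -, hC'⟩ := hh.derivative.exists_norm_le
  obtain ⟨C'', -, hC''⟩ := hh.derivative.derivative.exists_norm_le
  have hderiv := (hasDerivAt_integral_of_dominated_loc_of_deriv_le (μ := (volume : Measure ℂ))
    (F := fun s w ↦ Real.exp (-‖w‖ ^ 2) * h ((2 * s) • w))
    (F' := fun s w ↦ Real.exp (-‖w‖ ^ 2) * fderiv ℝ h ((2 * s) • w) ((2 : ℝ) • w))
    (x₀ := s) (bound := fun w ↦ 2 * C' * (‖w‖ * Real.exp (-‖w‖ ^ 2))) Filter.univ_mem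
    (.of_forall fun s ↦ by fun_prop)
    (integrable_gaussian_mul (by fun_prop) fun w ↦ hC _) (by fun_prop)
    (.of_forall fun w s _ ↦ ?_) (integrable_norm_mul_gaussian.const_mul _)
    (.of_forall fun w s _ ↦ ?_)).2
  · refine hderiv.congr_deriv ?_
    have hD (v w : ℂ) : ‖fderiv ℝ (fderiv ℝ h) w v v‖ ≤ C'' * ‖v‖ * ‖v‖ :=
      ((fderiv ℝ (fderiv ℝ h) w).le_opNorm₂ v v).trans (by gcongr; exact hC'' w)
    have ibp (v : ℂ) := integral_gaussian_mul_lineDeriv (v := v)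
      (f := fun w ↦ fderiv ℝ h ((2 * s) • w) v)
      (f' := fun w ↦ (2 * s) * fderiv ℝ (fderiv ℝ h) ((2 * s) • w) v v)
      (C := C' * ‖v‖) (C' := ‖2 * s‖ * (C'' * ‖v‖ * ‖v‖)) (fun w ↦ ?_)
      (by fun_prop) (by fun_prop)
      (fun w ↦ (fderiv ℝ h _).le_of_opNorm_le (hC' _) v) (fun w ↦ ?_)
    · have hint (v : ℂ) := integrable_gaussian_mul
        (f := fun w ↦ (2 * s) * fderiv ℝ (fderiv ℝ h) ((2 * s) • w) v v) (by fun_prop)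
        (C := ‖2 * s‖ * (C'' * ‖v‖ * ‖v‖))
        fun w ↦ by rw [norm_mul]; gcongr; exact hD v _
      calc ∫ w : ℂ, Real.exp (-‖w‖ ^ 2) * fderiv ℝ h ((2 * s) • w) ((2 : ℝ) • w)
          = ∫ w : ℂ, (2 * (inner ℝ w 1 * Real.exp (-‖w‖ ^ 2) * fderiv ℝ h ((2 * s) • w) 1)
            + 2 * (inner ℝ w Complex.I * Real.exp (-‖w‖ ^ 2)
              * fderiv ℝ h ((2 * s) • w) Complex.I)) := by
            congr 1 with w
            have hw : w = (inner ℝ w 1 : ℝ) • (1 : ℂ) + (inner ℝ w Complex.I : ℝ) • Complex.I := by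
              apply Complex.ext <;> simp [Complex.inner]
            have hL (L : ℂ →L[ℝ] ℝ) :
                L w = inner ℝ w 1 * L 1 + inner ℝ w Complex.I * L Complex.I := by
              conv_lhs => rw [hw]
              simp only [map_add, map_smul, smul_eq_mul]
            rw [map_smul, hL, smul_eq_mul]
            ring
        _ = ∫ w : ℂ, (Real.exp (-‖w‖ ^ 2)
              * ((2 * s) * fderiv ℝ (fderiv ℝ h) ((2 * s) • w) 1 1)
            + Real.exp (-‖w‖ ^ 2)
              * ((2 * s) * fderiv ℝ (fderiv ℝ h) ((2 * s) • w) Complex.I Complex.I)) := by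
            rw [integral_add (ibp 1).1 (ibp Complex.I).1, ← (ibp 1).2, ← (ibp Complex.I).2,
              integral_add (hint 1) (hint Complex.I)]
        _ = _ := by
            rw [← integral_const_mul]
            congr 1 with w
            rw [laplacian_eq_fderiv_fderiv]
            ring
    · have h1 : HasFDerivAt (fun w : ℂ ↦ (2 * s) • w)
          ((2 * s) • ContinuousLinearMap.id ℝ ℂ) w := (hasFDerivAt_id w).const_smul (2 * s)
      have h2 := ((hh.derivative.hasFDerivAt ((2 * s) • w)).comp w h1).clm_apply
        (hasFDerivAt_const v w)
      simpa using h2.hasLineDerivAt v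
    · rw [norm_mul]
      gcongr
      exact hD v _
  · rw [norm_mul, Real.norm_of_nonneg (Real.exp_pos _).le]
    have := (fderiv ℝ h ((2 * s) • w)).le_of_opNorm_le (hC' _) ((2 : ℝ) • w)
    rw [norm_smul, Real.norm_ofNat] at this
    nlinarith [Real.exp_pos (-‖w‖ ^ 2)]
  · refine HasDerivAt.const_mul _ ?_
    have h1 : HasDerivAt (fun s : ℝ ↦ (2 * s) • w) ((2 : ℝ) • w) s := by
      simpa using ((hasDerivAt_id s).const_mul 2).smul_const w
    exact (hh.hasFDerivAt _).comp_hasDerivAt s h1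

/-! ### The resolvent of the Laplacian -/

/-- An unnormalised Gaussian mixture on `(0, ∞) × ℂ`: the image of this measure under
`(s, w) ↦ 2 s w` is `π` times the fundamental solution of `1 - Δ`. -/
noncomputable def resolventMeasure : Measure (ℝ × ℂ) :=
  ((volume : Measure (ℝ × ℂ)).restrict (Ioi 0 ×ˢ univ)).withDensity fun p ↦
    ENNReal.ofReal (2 * p.1 * Real.exp (-p.1 ^ 2) * Real.exp (-‖p.2‖ ^ 2))

theorem integrable_resolvent_density :
    Integrable (fun p : ℝ × ℂ ↦ 2 * p.1 * Real.exp (-p.1 ^ 2) * Real.exp (-‖p.2‖ ^ 2)) := by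
  refine Integrable.mul_prod (f := fun s : ℝ ↦ 2 * s * Real.exp (-s ^ 2)) ?_ integrable_gaussian
  simpa [mul_assoc] using (integrable_mul_exp_neg_mul_sq one_pos).const_mul 2

instance : IsFiniteMeasure resolventMeasure :=
  isFiniteMeasure_withDensity_ofReal integrable_resolvent_density.restrict.hasFiniteIntegral

theorem measurable_two_mul_smul : Measurable fun p : ℝ × ℂ ↦ (2 * p.1) • p.2 := by fun_prop

theorem resolventMeasure_pos {U : Set (ℝ × ℂ)} (hU : IsOpen U)
    (hne : (U ∩ Ioi 0 ×ˢ univ).Nonempty) : 0 < resolventMeasure U := by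
  have hS : MeasurableSet (Ioi (0 : ℝ) ×ˢ (univ : Set ℂ)) := measurableSet_Ioi.prod .univ
  refine pos_iff_ne_zero.2 fun h0 ↦ ?_
  have hac := withDensity_absolutelyContinuous'
    (μ := volume.restrict (Ioi (0 : ℝ) ×ˢ (univ : Set ℂ)))
    (f := fun p ↦ ENNReal.ofReal (2 * p.1 * Real.exp (-p.1 ^ 2) * Real.exp (-‖p.2‖ ^ 2)))
    (by fun_prop) ((ae_restrict_iff' hS).2 (.of_forall fun p hp ↦ by
      have : 0 < p.1 := hp.1
      rw [ne_eq, ENNReal.ofReal_eq_zero, not_le]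
      positivity))
  have h1 := hac h0
  rw [Measure.restrict_apply hU.measurableSet] at h1
  exact ((hU.inter (isOpen_Ioi.prod isOpen_univ)).measure_pos _ hne).ne' h1

theorem integral_resolventMeasure {f : ℂ → ℝ} (hf : Continuous f) {C : ℝ}
    (hC : ∀ w, ‖f w‖ ≤ C) :
    IntegrableOn (fun s : ℝ ↦ 2 * s * Real.exp (-s ^ 2)
      * ∫ w : ℂ, Real.exp (-‖w‖ ^ 2) * f ((2 * s) • w)) (Ioi 0) ∧
    ∫ p, f ((2 * p.1) • p.2) ∂resolventMeasure
      = ∫ s in Ioi (0 : ℝ), 2 * s * Real.exp (-s ^ 2)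
        * ∫ w : ℂ, Real.exp (-‖w‖ ^ 2) * f ((2 * s) • w) := by
  have hint : Integrable (fun p : ℝ × ℂ ↦ 2 * p.1 * Real.exp (-p.1 ^ 2)
      * (Real.exp (-‖p.2‖ ^ 2) * f ((2 * p.1) • p.2))) := by
    simpa only [mul_assoc] using integrable_resolvent_density.mul_bdd
      (g := fun p : ℝ × ℂ ↦ f ((2 * p.1) • p.2)) (by fun_prop) (.of_forall fun p ↦ hC _)
  have hS : MeasurableSet (Ioi (0 : ℝ) ×ˢ (univ : Set ℂ)) := measurableSet_Ioi.prod .univ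
  constructor
  · have := Integrable.integral_prod_left hint
    simp only [integral_const_mul] at this
    exact this.integrableOn
  · rw [resolventMeasure, integral_withDensity_eq_integral_toReal_smul (by fun_prop)
      (.of_forall fun _ ↦ ENNReal.ofReal_lt_top)]
    calc _ = ∫ p in Ioi (0 : ℝ) ×ˢ (univ : Set ℂ), 2 * p.1 * Real.exp (-p.1 ^ 2)
          * (Real.exp (-‖p.2‖ ^ 2) * f ((2 * p.1) • p.2)) := by
          refine setIntegral_congr_fun hS fun p hp ↦ ?_
          have : 0 < p.1 := hp.1
          simp only [smul_eq_mul]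
          rw [ENNReal.toReal_ofReal (by positivity)]
          ring
      _ = _ := by
          rw [Measure.volume_eq_prod, setIntegral_prod _ hint.integrableOn]
          simp only [integral_const_mul, Measure.restrict_univ]

theorem IsBoundedSmooth.integral_resolventMeasure_sub_laplacian {h : ℂ → ℝ}
    (hh : IsBoundedSmooth h) :
    ∫ p, h ((2 * p.1) • p.2) ∂resolventMeasure
      - ∫ p, laplacian h ((2 * p.1) • p.2) ∂resolventMeasure = Real.pi * h 0 := by
  obtain ⟨C, -, hC⟩ := hh.exists_norm_le
  obtain ⟨C', hC'⟩ := hh.laplacian_bounded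
  obtain ⟨hi, he⟩ := integral_resolventMeasure hh.continuous hC
  obtain ⟨hi', he'⟩ := integral_resolventMeasure hh.laplacian_continuous hC'
  rw [he, he', ← integral_sub hi hi']
  set V : ℝ → ℝ := fun s ↦ ∫ w : ℂ, Real.exp (-‖w‖ ^ 2) * h ((2 * s) • w) with hV
  have hVb (s : ℝ) : ‖V s‖ ≤ Real.pi * C := by
    rw [← integral_gaussian_complex_norm, ← integral_mul_const]
    refine norm_integral_le_of_norm_le (integrable_gaussian.mul_const C) (.of_forall fun w ↦ ?_)
    rw [norm_mul, Real.norm_of_nonneg (Real.exp_pos _).le]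
    gcongr
    exact hC _
  have hd (s : ℝ) : HasDerivAt (fun s ↦ -(Real.exp (-s ^ 2) * V s))
      (2 * s * Real.exp (-s ^ 2) * V s - 2 * s * Real.exp (-s ^ 2)
        * ∫ w : ℂ, Real.exp (-‖w‖ ^ 2) * laplacian h ((2 * s) • w)) s := by
    have h1 : HasDerivAt (fun s : ℝ ↦ Real.exp (-s ^ 2)) (Real.exp (-s ^ 2) * -(2 * s)) s := by
      simpa using ((hasDerivAt_pow 2 s).neg).exp
    refine (h1.mul (hh.hasDerivAt_gaussian_integral s)).neg.congr_deriv ?_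
    simp only [hV]
    ring
  have ht : Tendsto (fun s ↦ -(Real.exp (-s ^ 2) * V s)) atTop (𝓝 0) := by
    rw [← neg_zero]
    refine Tendsto.neg (Tendsto.zero_mul_isBoundedUnder_le ?_ ?_)
    · exact Real.tendsto_exp_atBot.comp
        (tendsto_neg_atTop_atBot.comp (tendsto_pow_atTop two_ne_zero))
    · exact isBoundedUnder_of ⟨_, hVb⟩
  rw [integral_Ioi_of_hasDerivAt_of_tendsto (hd 0).continuousAt.continuousWithinAt
    (fun s _ ↦ hd s) (hi.sub hi') ht]
  simp [hV, integral_mul_const, integral_gaussian_complex_norm]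

theorem resolventMeasure_preimage_ball_pos (a : ℂ) {r : ℝ} (hr : 0 < r) :
    0 < resolventMeasure.real ((fun p : ℝ × ℂ ↦ (2 * p.1) • p.2) ⁻¹' Metric.ball a r) := by
  refine ENNReal.toReal_pos (resolventMeasure_pos
    (Metric.isOpen_ball.preimage (by fun_prop)) ⟨(1 / 2, a), ?_⟩).ne' (measure_ne_top _ _)
  simp [hr]

/-- The resolvent kernel gives uniformly positive mass to balls of fixed radius with centre in a
compact set. -/
theorem exists_le_resolventMeasure_preimage_ball {K : Set ℂ} (hK : IsCompact K) {r : ℝ}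
    (hr : 0 < r) : ∃ ε > 0, ∀ a ∈ K,
      ε ≤ resolventMeasure.real ((fun p : ℝ × ℂ ↦ (2 * p.1) • p.2) ⁻¹' Metric.ball a r) := by
  refine hK.induction_on ⟨1, one_pos, by simp⟩ ?_ ?_ fun x _ ↦ ?_
  · rintro s t hst ⟨ε, hε, h⟩
    exact ⟨ε, hε, fun a ha ↦ h a (hst ha)⟩
  · rintro s t ⟨ε, hε, h⟩ ⟨ε', hε', h'⟩
    exact ⟨min ε ε', lt_min hε hε', fun a ha ↦ ha.elim (fun ha ↦ min_le_of_left_le (h a ha))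
      fun ha ↦ min_le_of_right_le (h' a ha)⟩
  · refine ⟨Metric.ball x (r / 2), mem_nhdsWithin_of_mem_nhds (Metric.ball_mem_nhds x (half_pos hr)),
      _, resolventMeasure_preimage_ball_pos x (half_pos hr), fun a ha ↦ ?_⟩
    refine measureReal_mono (preimage_mono (Metric.ball_subset_ball' ?_))
    rw [dist_comm]
    linarith [Metric.mem_ball.1 ha]

theorem exists_pos_le_integral_resolventMeasure {g : ℂ → ℝ} (hg : IsBoundedSmooth g)
    (hg0 : ∀ z, 0 ≤ g z) {δ R : ℝ} (hδ : 0 < δ)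
    (hnd : ∀ p : ℂ, δ ≤ sSup (g '' Metric.closedBall p R)) (hR : 0 ≤ R) :
    ∃ η > 0, ∀ z, η ≤ ∫ p, g (z + (2 * p.1) • p.2) ∂resolventMeasure := by
  obtain ⟨C, hC0, hC⟩ := hg.derivative.exists_norm_le
  obtain ⟨r, hr, hrC⟩ : ∃ r > 0, C * r ≤ δ / 4 := by
    refine ⟨δ / 4 / (C + 1), by positivity, ?_⟩
    rw [mul_div_assoc', div_le_iff₀ (by positivity)]
    nlinarith
  obtain ⟨ε, hε, hball⟩ :=
    exists_le_resolventMeasure_preimage_ball (isCompact_closedBall (0 : ℂ) R) hr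
  refine ⟨ε * (δ / 4), by positivity, fun z ↦ ?_⟩
  obtain ⟨_, ⟨q, hq, rfl⟩, hgq⟩ := exists_lt_of_lt_csSup
    ((Metric.nonempty_closedBall.2 hR).image g) ((half_lt_self hδ).trans_le (hnd z))
  set S := (fun p : ℝ × ℂ ↦ (2 * p.1) • p.2) ⁻¹' Metric.ball (q - z) r with hS
  have hSm : MeasurableSet S := Metric.isOpen_ball.measurableSet.preimage measurable_two_mul_smul
  have hint := hg.integrable_comp_const_add (μ := resolventMeasure) measurable_two_mul_smul z
  calc ε * (δ / 4) ≤ resolventMeasure.real S * (δ / 4) := by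
        gcongr
        exact hball _ (by simpa [dist_eq_norm] using hq)
    _ = ∫ p in S, δ / 4 ∂resolventMeasure := by simp
    _ ≤ ∫ p in S, g (z + (2 * p.1) • p.2) ∂resolventMeasure := by
        refine setIntegral_mono_on (by simp) hint.integrableOn hSm fun p hp ↦ ?_
        have hlip := convex_univ.norm_image_sub_le_of_norm_fderiv_le
          (fun x _ ↦ (hg.hasFDerivAt x).differentiableAt) (fun x _ ↦ hC x)
          (mem_univ q) (mem_univ (z + (2 * p.1) • p.2))
        have hd : ‖z + (2 * p.1) • p.2 - q‖ ≤ r := by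
          have := (Metric.mem_ball.1 hp).le
          rw [dist_eq_norm] at this
          rwa [add_sub_right_comm, ← neg_sub, ← sub_eq_neg_add]
        have := hlip.trans ((mul_le_mul_of_nonneg_left hd hC0).trans hrC)
        rw [Real.norm_eq_abs] at this
        linarith [(abs_le.1 this).1]
    _ ≤ ∫ p, g (z + (2 * p.1) • p.2) ∂resolventMeasure :=
        setIntegral_le_integral hint (.of_forall fun p ↦ hg0 _)

theorem laplacian_const_add (h : ℂ → ℝ) (a x : ℂ) :
    laplacian (fun z ↦ h (a + z)) x = laplacian h (a + x) := by
  simp only [laplacian, iteratedFDeriv_comp_add_left]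

theorem IsBoundedSmooth.iteratedFDeriv_const_mul {h : ℂ → ℝ} (hh : IsBoundedSmooth h) (c : ℝ)
    (k : ℕ) (x : ℂ) :
    iteratedFDeriv ℝ k (fun z ↦ c * h z) x = c • iteratedFDeriv ℝ k h x := by
  have hk : ContDiffAt ℝ k h x := (contDiff_infty.1 hh.1 k).contDiffAt
  simpa only [smul_eq_mul] using iteratedFDeriv_const_smul_apply' (a := c) hk

theorem IsBoundedSmooth.laplacian_const_mul {h : ℂ → ℝ} (hh : IsBoundedSmooth h) (c : ℝ)
    (x : ℂ) : laplacian (fun z ↦ c * h z) x = c * laplacian h x := by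
  simp [laplacian, hh.iteratedFDeriv_const_mul, mul_add]

theorem stmt_3 (g : ℂ → ℝ) (hg0 : ∀ z : ℂ, 0 ≤ g z) (hg : ContDiff ℝ (⊤ : ℕ∞) g)
    (hgk : ∀ k : ℕ, ∃ C : ℝ, ∀ z : ℂ, ‖iteratedFDeriv ℝ k g z‖ ≤ C)
    (hnd : ∃ δ > (0:ℝ), ∃ R > (0:ℝ), ∀ p : ℂ,
      δ ≤ sSup (g '' Metric.closedBall p R)) :
    ∃ φ : ℂ → ℝ, ContDiff ℝ (⊤ : ℕ∞) φ ∧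
      (∀ z : ℂ, -laplacian φ z + φ z = -g z) ∧
      (∀ k : ℕ, ∃ C : ℝ, ∀ z : ℂ, ‖iteratedFDeriv ℝ k φ z‖ ≤ C) ∧
      (⨆ z : ℂ, φ z) < 0 := by
  have hb : IsBoundedSmooth g := ⟨hg, hgk⟩
  obtain ⟨δ, hδ, R, hR, hnd⟩ := hnd
  obtain ⟨η, hη, hle⟩ := exists_pos_le_integral_resolventMeasure hb hg0 hδ hnd hR.le
  have hu := hb.integral_translate (μ := resolventMeasure) measurable_two_mul_smul
  set u : ℂ → ℝ := fun z ↦ ∫ p, g (z + (2 * p.1) • p.2) ∂resolventMeasure with hu_def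
  refine ⟨fun z ↦ -Real.pi⁻¹ * u z, contDiff_const.mul hu.1, fun z ↦ ?_, fun k ↦ ?_, ?_⟩
  · have h1 := (hb.comp_const_add z).integral_resolventMeasure_sub_laplacian
    simp only [laplacian_const_add, add_zero] at h1
    rw [hu.laplacian_const_mul, hu_def, hb.laplacian_integral_translate measurable_two_mul_smul]
    have hpi := Real.pi_ne_zero
    field_simp
    linarith
  · obtain ⟨C, hC⟩ := hu.2 k
    refine ⟨‖-Real.pi⁻¹‖ * C, fun z ↦ ?_⟩
    rw [hu.iteratedFDeriv_const_mul, norm_smul]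
    gcongr
    exact hC z
  · refine (ciSup_le fun z ↦ ?_ : _ ≤ -(Real.pi⁻¹ * η)).trans_lt (by simp; positivity)
    have := mul_le_mul_of_nonneg_left (hle z) (inv_nonneg.2 Real.pi_pos.le)
    linarith
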